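/- arXiv:2605.19904 — 4 statements merged into one kernel-verified Lean document; each statement's English description precedes it below -/
import Mathlib

section
/- For all integers n ≥ 0 and k ≥ 0 and every real number x with x ≠ 1, one has ∑_{d=0}^{k} d^n x^d = ∑_{i=0}^{n} (e_{n,i} x^i − e^k_{n,i} x^{k+i+1}) / (1−x)^{n+1}. -/
/-- The classical Eulerian numbers `e_{n,i}`: `e_{0,0} = 1`, `e_{n,i} = 0` whenever
`i ≤ 0` (unless `n = i = 0`) or `i > n`, and otherwise
`e_{n,i} = i·e_{n-1,i} + (n-i+1)·e_{n-1,i-1}`. -/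
def eul : ℕ → ℕ → ℤ
  | 0, 0 => 1
  | 0, _ + 1 => 0
  | _ + 1, 0 => 0
  | n + 1, i + 1 =>
    if i + 1 > n + 1 then 0
    else ((i : ℤ) + 1) * eul n (i + 1) + ((n : ℤ) - i + 1) * eul n i

/-- The extended Eulerian numbers `e^k_{n,i}`: `e^k_{0,0} = 1`, `e^k_{n,i} = 0` whenever
`i < 0` or `i > n`, and otherwise
`e^k_{n,i} = (k+i+1)·e^k_{n-1,i} + (n-k-i)·e^k_{n-1,i-1}`. -/
def eulk (k : ℕ) : ℕ → ℕ → ℤ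
  | 0, 0 => 1
  | 0, _ + 1 => 0
  | n + 1, 0 => ((k : ℤ) + 1) * eulk k n 0
  | n + 1, i + 1 =>
    if i + 1 > n + 1 then 0
    else ((k : ℤ) + (i + 1) + 1) * eulk k n (i + 1) + ((n : ℤ) - k - i) * eulk k n i

open Polynomial in
/-- A triangular array obeying an Eulerian-type recurrence with shift `s` yields row polynomials
obeying the differential recurrence `P ↦ X (1 - X) P' + (n + 1) X P`. -/
lemma sum_C_mul_X_pow_succ_of_recurrence (s n : ℕ) (c c' : ℕ → ℤ) (hc : c (n + 1) = 0)
    (h_zero : c' 0 = s * c 0)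
    (h_succ : ∀ i ≤ n, c' (i + 1) = (s + (i + 1)) * c (i + 1) + (n + 1 - s - i) * c i) :
    ∑ i ∈ Finset.range (n + 2), (C (c' i) * X ^ (s + i) : ℤ[X]) =
      X * (1 - X) * derivative (∑ i ∈ Finset.range (n + 1), C (c i) * X ^ (s + i)) +
        ((n : ℤ[X]) + 1) * X * ∑ i ∈ Finset.range (n + 1), C (c i) * X ^ (s + i) := by
  have X_mul_derivative (i : ℕ) :
      X * derivative (C (c i) * X ^ (s + i) : ℤ[X]) =
        ((s : ℤ[X]) + (i : ℤ[X])) * (C (c i) * X ^ (s + i)) := by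
    rcases hm : s + i with _ | m
    · obtain ⟨rfl, rfl⟩ : s = 0 ∧ i = 0 := by omega
      simp
    · have : (s : ℤ[X]) + (i : ℤ[X]) = (m : ℤ[X]) + 1 := by exact_mod_cast hm
      rw [this]
      simp [derivative_mul]
      ring
  have h_shift : ∑ i ∈ Finset.range (n + 1), ((s : ℤ[X]) + (i : ℤ[X])) * (C (c i) * X ^ (s + i)) =
      (s : ℤ[X]) * (C (c 0) * X ^ s) + ∑ i ∈ Finset.range (n + 1),
        ((s : ℤ[X]) + ((i : ℤ[X]) + 1)) * (C (c (i + 1)) * X ^ (s + (i + 1))) := by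
    have h := Finset.sum_range_succ
      (fun i : ℕ => ((s : ℤ[X]) + (i : ℤ[X])) * (C (c i) * X ^ (s + i))) (n + 1)
    rw [Finset.sum_range_succ'] at h
    simp only [hc, map_zero, zero_mul, mul_zero, add_zero, Nat.cast_zero] at h
    rw [← h, add_comm]
    push_cast
    rfl
  have h_rhs : X * (1 - X) * derivative (∑ i ∈ Finset.range (n + 1), C (c i) * X ^ (s + i)) +
      ((n : ℤ[X]) + 1) * X * ∑ i ∈ Finset.range (n + 1), C (c i) * X ^ (s + i) =
      ∑ i ∈ Finset.range (n + 1), ((s : ℤ[X]) + (i : ℤ[X])) * (C (c i) * X ^ (s + i)) +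
      ∑ i ∈ Finset.range (n + 1), ((n : ℤ[X]) + 1 - (s : ℤ[X]) - (i : ℤ[X])) *
        (C (c i) * X ^ (s + (i + 1))) := by
    rw [derivative_sum, Finset.mul_sum, Finset.mul_sum, ← Finset.sum_add_distrib,
      ← Finset.sum_add_distrib]
    refine Finset.sum_congr rfl fun i _ => ?_
    linear_combination (1 - X) * X_mul_derivative i
  rw [h_rhs, h_shift, Finset.sum_range_succ', add_comm, add_assoc, ← Finset.sum_add_distrib]
  congr 1
  · simp [h_zero, mul_assoc]
  · refine Finset.sum_congr rfl fun i hi => ?_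
    rw [h_succ i (Finset.mem_range_succ_iff.mp hi)]
    simp
    ring

lemma eul_eq_zero_of_lt {n i : ℕ} (h : n < i) : eul n i = 0 := by
  obtain ⟨i, rfl⟩ := Nat.exists_eq_add_one_of_ne_zero (Nat.ne_zero_of_lt h)
  cases n with
  | zero => simp [eul]
  | succ n => simp only [eul, if_pos h]

lemma eulk_eq_zero_of_lt {k n i : ℕ} (h : n < i) : eulk k n i = 0 := by
  obtain ⟨i, rfl⟩ := Nat.exists_eq_add_one_of_ne_zero (Nat.ne_zero_of_lt h)
  cases n with
  | zero => simp [eulk]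
  | succ n => simp only [eulk, if_pos h]

open Polynomial in
lemma one_sub_X_pow_mul_sum_pow_mul_X_pow (n k : ℕ) :
    (1 - X) ^ (n + 1) * ∑ d ∈ Finset.range (k + 1), ((d : ℤ[X]) ^ n * X ^ d) =
      ∑ i ∈ Finset.range (n + 1), C (eul n i) * X ^ (0 + i) -
        ∑ i ∈ Finset.range (n + 1), C (eulk k n i) * X ^ (k + 1 + i) := by
  induction n with
  | zero => simpa [eul, eulk] using mul_neg_geom_sum (X : ℤ[X]) (k + 1)
  | succ n ih =>
    rw [sum_C_mul_X_pow_succ_of_recurrence 0 n (eul n) (eul (n + 1))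
        (eul_eq_zero_of_lt n.lt_succ_self) (by simp [eul])
        (fun i hi => by rw [eul, if_neg (by omega)]; push_cast; ring),
      sum_C_mul_X_pow_succ_of_recurrence (k + 1) n (eulk k n) (eulk k (n + 1))
        (eulk_eq_zero_of_lt n.lt_succ_self) (by simp [eulk])
        (fun i hi => by rw [eulk, if_neg (by omega)]; push_cast; ring)]
    have h_sum : ∑ d ∈ Finset.range (k + 1), ((d : ℤ[X]) ^ (n + 1) * X ^ d) =
        X * derivative (∑ d ∈ Finset.range (k + 1), ((d : ℤ[X]) ^ n * X ^ d)) := by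
      rw [derivative_sum, Finset.mul_sum]
      refine Finset.sum_congr rfl fun d _ => ?_
      have h_const : derivative ((d : ℤ[X]) ^ n) = 0 := by
        rw [← Nat.cast_pow, derivative_natCast]
      rw [derivative_mul, h_const, derivative_X_pow]
      cases d with
      | zero => simp
      | succ d => simp; ring
    have h_deriv := congrArg derivative ih
    rw [derivative_mul, derivative_sub, derivative_pow] at h_deriv
    simp only [derivative_sub, derivative_one, derivative_X, Nat.add_sub_cancel, map_add,
      map_natCast, Nat.cast_add, Nat.cast_one, map_one] at h_deriv
    rw [h_sum]
    linear_combination X * (1 - X) * h_deriv + (n + 1) * X * ih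

theorem stmt_0 (n k : ℕ) (x : ℝ) (hx : x ≠ 1) :
    ∑ d ∈ Finset.range (k + 1), (d : ℝ) ^ n * x ^ d =
      ∑ i ∈ Finset.range (n + 1),
        ((eul n i : ℝ) * x ^ i - (eulk k n i : ℝ) * x ^ (k + i + 1)) / (1 - x) ^ (n + 1) := by
  have hx' : (1 - x) ^ (n + 1) ≠ 0 := pow_ne_zero _ (sub_ne_zero.mpr hx.symm)
  have h := congrArg (Polynomial.aeval x) (one_sub_X_pow_mul_sum_pow_mul_X_pow n k)
  simp only [map_mul, map_pow, map_sub, map_sum, map_one, map_natCast, map_intCast,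
    Polynomial.aeval_X, eq_intCast, zero_add] at h
  rw [← Finset.sum_div, eq_div_iff hx', mul_comm, h, ← Finset.sum_sub_distrib]
  simp only [add_right_comm k 1]
end

section
/- Let k ≥ 1 and let S = H^k (a run of k heads). Then E(Y^0) = 1, and for every integer n ≥ 1, E(Y^n) = k^n + ∑_{j=0}^{n−1} C(n, j) · E(Y^j) · ∑_{i=1}^{k} (1−p) · i^{n−j} / p^{k−i+1}. -/
/-- The probability of a given sequence of coin flips, where `true` stands for heads
(probability `p`) and `false` for tails (probability `1 - p`). -/
def coinP (p : ℝ) (w : List Bool) : ℝ := (w.map fun b => if b then p else 1 - p).prod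

/-- The number of occurrences of `S` as a factor (consecutive substring) of `w`. -/
def numOccs (S w : List Bool) : ℕ :=
  ((Finset.range (w.length + 1)).filter fun i => (w.drop i).take S.length = S).card

/-- `coinZ S` is the set of finite binary strings in which `S` occurs exactly once as a
factor, namely as a suffix. -/
def coinZ (S : List Bool) : Set (List Bool) := {w | S <:+ w ∧ numOccs S w = 1}

/-- The `n`-th moment `E(Y^n) = ∑_{w ∈ Z(S)} |w|^n P(w)` of the number of coin flips
needed to produce `S`. -/
noncomputable def coinE (p : ℝ) (S : List Bool) (n : ℕ) : ℝ :=
  ∑' w : coinZ S, (w.1.length : ℝ) ^ n * coinP p w.1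

lemma numOccs_cons (S : List Bool) (a : Bool) (w : List Bool) :
    numOccs S (a :: w) = (if S <+: a :: w then 1 else 0) + numOccs S w := by
  simp only [numOccs, Finset.card_filter, List.length_cons]
  rw [Finset.sum_range_succ']
  simp only [List.drop_succ_cons, List.drop_zero, List.prefix_iff_eq_take, eq_comm (a := S)]
  rw [add_comm]

lemma numOccs_eq_zero_of_length_lt {S w : List Bool} (h : w.length < S.length) :
    numOccs S w = 0 := by
  simp only [numOccs, Finset.card_eq_zero, Finset.filter_eq_empty_iff]
  intro i _ hi
  have := congrArg List.length hi
  simp only [List.length_take, List.length_drop] at this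
  omega

lemma one_le_numOccs_of_suffix {S w : List Bool} (h : S <:+ w) : 1 ≤ numOccs S w := by
  obtain ⟨t, rfl⟩ := h
  refine Finset.card_pos.2 ⟨t.length, ?_⟩
  simp

lemma numOccs_self {S : List Bool} (h : S ≠ []) : numOccs S S = 1 := by
  obtain ⟨a, w, rfl⟩ := List.exists_cons_of_ne_nil h
  rw [numOccs_cons, numOccs_eq_zero_of_length_lt (by simp)]
  simp

lemma eq_of_mem_coinZ_of_prefix {S w : List Bool} (hS : S ≠ []) (hw : w ∈ coinZ S)
    (h : S <+: w) : w = S := by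
  obtain ⟨hs, ho⟩ := hw
  cases w with
  | nil => exact (hS (List.prefix_nil.1 h)).elim
  | cons a w =>
    rw [numOccs_cons, if_pos h] at ho
    rcases List.suffix_cons_iff.1 hs with h' | h'
    · exact h'.symm
    · have := one_le_numOccs_of_suffix h'
      omega

lemma not_replicate_prefix {i k : ℕ} (hik : i < k) (w : List Bool) :
    ¬ List.replicate k true <+: List.replicate i true ++ false :: w := by
  intro h
  have h1 := h.getElem (i := i) (by simpa using hik)
  simp at h1

lemma replicate_append_false_mem_coinZ_iff {i k : ℕ} (hik : i < k) (w : List Bool) :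
    List.replicate i true ++ false :: w ∈ coinZ (List.replicate k true) ↔
      w ∈ coinZ (List.replicate k true) := by
  have key : ∀ a v, ¬ List.replicate k true <+: a :: v →
      (a :: v ∈ coinZ (List.replicate k true) ↔ v ∈ coinZ (List.replicate k true)) := by
    intro a v h
    simp only [coinZ, Set.mem_ofPred_eq, numOccs_cons, if_neg h, zero_add, List.suffix_cons_iff]
    have : List.replicate k true ≠ a :: v := fun h' => h (h' ▸ List.prefix_rfl)
    simp [this]
  induction i with
  | zero => exact key _ _ (not_replicate_prefix hik w)
  | succ i ih =>
    exact (key _ _ (not_replicate_prefix hik w)).trans (ih (by omega))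

lemma replicate_prefix_or_eq (k : ℕ) (w : List Bool) :
    List.replicate k true <+: w ∨ w.length < k ∨
      ∃ i < k, ∃ v, w = List.replicate i true ++ false :: v := by
  induction k generalizing w with
  | zero => simp
  | succ k ih =>
    rcases w with _ | ⟨_ | _, w⟩
    · simp
    · exact .inr (.inr ⟨0, by omega, w, rfl⟩)
    · rcases ih w with h | h | ⟨i, hi, v, rfl⟩
      · left
        simpa [List.replicate_succ] using h
      · exact .inr (.inl (by simpa using h))
      · exact .inr (.inr ⟨i + 1, by omega, v, rfl⟩)

lemma replicate_append_false_inj {i j : ℕ} {v w : List Bool}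
    (h : List.replicate i true ++ false :: v = List.replicate j true ++ false :: w) :
    i = j ∧ v = w := by
  induction i generalizing j with
  | zero => cases j <;> simp_all [List.replicate_succ]
  | succ i ih =>
    cases j with
    | zero => simp [List.replicate_succ] at h
    | succ j =>
      obtain ⟨h1, h2⟩ := @ih j (by simpa [List.replicate_succ] using h)
      exact ⟨by omega, h2⟩

/-- A word of `coinZ (H^k)` is either `H^k` or `H^i T w` with `i < k` and `w` in
`coinZ (H^k)`. -/
def runDecomp (k : ℕ) (hk : 1 ≤ k) :
    Option (Fin k × coinZ (List.replicate k true)) → coinZ (List.replicate k true)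
  | none => ⟨List.replicate k true, List.suffix_rfl, numOccs_self (by simp; omega)⟩
  | some (i, w) => ⟨List.replicate i true ++ false :: w.1,
      (replicate_append_false_mem_coinZ_iff i.2 w.1).2 w.2⟩

lemma runDecomp_bijective (k : ℕ) (hk : 1 ≤ k) : Function.Bijective (runDecomp k hk) := by
  constructor
  · rintro (_ | ⟨i, v⟩) (_ | ⟨j, w⟩) h
    · rfl
    · have h' : List.replicate k true = _ := congrArg Subtype.val h
      exact (not_replicate_prefix j.2 w.1 ⟨[], by simpa using! h'⟩).elim
    · have h' : _ = List.replicate k true := congrArg Subtype.val h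
      exact (not_replicate_prefix i.2 v.1 ⟨[], by simpa using! h'.symm⟩).elim
    · obtain ⟨h1, h2⟩ := replicate_append_false_inj (congrArg Subtype.val h)
      rw [Fin.ext h1, Subtype.ext h2]
  · rintro ⟨w, hw⟩
    rcases replicate_prefix_or_eq k w with h | h | ⟨i, hi, v, rfl⟩
    · exact ⟨none, Subtype.ext (eq_of_mem_coinZ_of_prefix (by simp; omega) hw h).symm⟩
    · have := hw.1.length_le
      simp only [List.length_replicate] at this
      omega
    · exact ⟨some (⟨i, hi⟩, ⟨v, (replicate_append_false_mem_coinZ_iff hi v).1 hw⟩), rfl⟩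

lemma coinP_nonneg {p : ℝ} (hp : 0 ≤ p) (hp1 : p ≤ 1) (w : List Bool) : 0 ≤ coinP p w := by
  refine List.prod_nonneg fun x hx => ?_
  obtain ⟨b, -, rfl⟩ := List.mem_map.1 hx
  split_ifs <;> linarith

lemma coinP_replicate (p : ℝ) (k : ℕ) : coinP p (List.replicate k true) = p ^ k := by
  simp [coinP]

lemma coinP_replicate_append_false (p : ℝ) (i : ℕ) (w : List Bool) :
    coinP p (List.replicate i true ++ false :: w) = p ^ i * (1 - p) * coinP p w := by
  simp [coinP, mul_assoc]

lemma sum_pow_mul_one_sub (p : ℝ) (k : ℕ) :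
    ∑ i : Fin k, p ^ (i : ℕ) * (1 - p) = 1 - p ^ k := by
  rw [← Finset.sum_mul, Fin.sum_univ_eq_sum_range (fun i => p ^ i), geom_sum_mul_neg]

lemma exists_one_lt_sum_lt_one {p : ℝ} (hp : 0 < p) (k : ℕ) :
    ∃ x : ℝ, 1 < x ∧ ∑ i : Fin k, p ^ (i : ℕ) * (1 - p) * x ^ ((i : ℕ) + 1) < 1 := by
  have hc : Continuous fun x : ℝ =>
      ∑ i : Fin k, p ^ (i : ℕ) * (1 - p) * x ^ ((i : ℕ) + 1) := by fun_prop
  have h1 : ∑ i : Fin k, p ^ (i : ℕ) * (1 - p) * (1 : ℝ) ^ ((i : ℕ) + 1) < 1 := by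
    simp only [one_pow, mul_one, sum_pow_mul_one_sub]
    linarith [pow_pos hp k]
  have h2 : ∀ᶠ x in nhdsWithin (1 : ℝ) (Set.Ioi 1),
      ∑ i : Fin k, p ^ (i : ℕ) * (1 - p) * x ^ ((i : ℕ) + 1) < 1 :=
    (hc.tendsto 1).eventually_lt_const h1 |>.filter_mono nhdsWithin_le_nhds
  obtain ⟨x, hx, hx1⟩ := (h2.and self_mem_nhdsWithin).exists
  exact ⟨x, hx1, hx⟩

lemma sum_pow_length_mul_coinP_le {p : ℝ} (hp : 0 < p) (hp1 : p < 1) {k : ℕ} (hk : 1 ≤ k)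
    {x : ℝ} (hx : 0 ≤ x)
    (hr : ∑ i : Fin k, p ^ (i : ℕ) * (1 - p) * x ^ ((i : ℕ) + 1) < 1) (N : ℕ)
    (u : Finset (coinZ (List.replicate k true))) (hu : ∀ w ∈ u, w.1.length < N) :
    ∑ w ∈ u, x ^ w.1.length * coinP p w.1 ≤
      x ^ k * p ^ k / (1 - ∑ i : Fin k, p ^ (i : ℕ) * (1 - p) * x ^ ((i : ℕ) + 1)) := by
  classical
  set r := ∑ i : Fin k, p ^ (i : ℕ) * (1 - p) * x ^ ((i : ℕ) + 1) with hrdef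
  have hr0 : 0 ≤ r := Finset.sum_nonneg fun i _ =>
    mul_nonneg (mul_nonneg (pow_nonneg hp.le _) (by linarith)) (pow_nonneg hx _)
  have hf : ∀ w : List Bool, 0 ≤ x ^ w.length * coinP p w := fun w =>
    mul_nonneg (pow_nonneg hx _) (coinP_nonneg hp.le hp1.le w)
  induction N generalizing u with
  | zero =>
    have : u = ∅ := Finset.eq_empty_of_forall_notMem fun w hw => by simpa using hu w hw
    subst this
    simp only [Finset.sum_empty]
    exact div_nonneg (by positivity) (by linarith)
  | succ N ih =>
    let e := Equiv.ofBijective _ (runDecomp_bijective k hk)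
    let v := (u.map e.symm.toEmbedding).eraseNone
    have hv : ∀ i w, (i, w) ∈ v → runDecomp k hk (some (i, w)) ∈ u := by
      intro i w h
      simp only [v, Finset.mem_eraseNone, Finset.mem_map_equiv, Equiv.symm_symm] at h
      exact h
    have hsub : u ⊆ (Finset.insertNone
        (Finset.univ ×ˢ v.image Prod.snd)).map e.toEmbedding := by
      intro w hw
      rw [Finset.mem_map_equiv]
      rcases h : e.symm w with _ | ⟨i, y⟩
      · simp
      · simp only [Finset.some_mem_insertNone, Finset.mem_product, Finset.mem_univ, true_and,
          Finset.mem_image]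
        refine ⟨(i, y), ?_, rfl⟩
        simp only [v, Finset.mem_eraseNone, Finset.mem_map_equiv, Equiv.symm_symm]
        rw [← h, Equiv.apply_symm_apply]
        exact hw
    have ih' := ih (v.image Prod.snd) (by
      intro w hw
      obtain ⟨⟨i, y⟩, hy, rfl⟩ := Finset.mem_image.1 hw
      have := hu _ (hv i y hy)
      simp only [runDecomp, List.length_append, List.length_replicate, List.length_cons] at this
      simp only
      omega)
    calc ∑ w ∈ u, x ^ w.1.length * coinP p w.1
        ≤ _ := Finset.sum_le_sum_of_subset_of_nonneg hsub fun w _ _ => hf w.1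
      _ = x ^ k * p ^ k + r * ∑ w ∈ v.image Prod.snd, x ^ w.1.length * coinP p w.1 := by
        rw [Finset.sum_map, Finset.sum_insertNone, Finset.sum_product, hrdef,
          Finset.sum_mul_sum]
        simp only [e, Equiv.coe_toEmbedding, Equiv.ofBijective_apply, runDecomp,
          coinP_replicate, coinP_replicate_append_false, List.length_append,
          List.length_replicate, List.length_cons]
        congr 1
        refine Finset.sum_congr rfl fun i _ => Finset.sum_congr rfl fun w _ => ?_
        ring
      _ ≤ x ^ k * p ^ k + r * (x ^ k * p ^ k / (1 - r)) := by gcongr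
      _ = x ^ k * p ^ k / (1 - r) := by
        have : 1 - r ≠ 0 := by linarith
        field_simp
        ring

lemma summable_length_pow_mul_coinP {p : ℝ} (hp : 0 < p) (hp1 : p < 1) {k : ℕ} (hk : 1 ≤ k)
    (n : ℕ) :
    Summable fun w : coinZ (List.replicate k true) => (w.1.length : ℝ) ^ n * coinP p w.1 := by
  obtain ⟨x, hx, hr⟩ := exists_one_lt_sum_lt_one hp k
  have hP := coinP_nonneg hp.le hp1.le
  have hs : Summable fun w : coinZ (List.replicate k true) =>
      x ^ w.1.length * coinP p w.1 := by
    refine summable_of_sum_le (fun w => mul_nonneg (by positivity) (hP _)) fun u =>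
      sum_pow_length_mul_coinP_le hp hp1 hk (by linarith) hr
        (u.sup (fun w => w.1.length) + 1) u fun w hw => ?_
    exact Nat.lt_succ_of_le (Finset.le_sup (f := fun w => w.1.length) hw)
  obtain ⟨C, hC⟩ := (tendsto_pow_const_div_const_pow_of_one_lt n hx).bddAbove_range
  refine Summable.of_nonneg_of_le (fun w => mul_nonneg (by positivity) (hP _)) (fun w => ?_)
    (hs.mul_left C)
  have h := hC ⟨w.1.length, rfl⟩
  simp only at h
  rw [div_le_iff₀ (by positivity)] at h
  rw [← mul_assoc]
  exact mul_le_mul_of_nonneg_right h (hP _)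

lemma tsum_eq_add_sum_of_optionProd_equiv {ι α : Type*} [Fintype ι] (e : Option (ι × α) ≃ α)
    {F : α → ℝ} (hF : Summable F) {g : ι → ℝ}
    (hg : ∀ i, HasSum (fun a => F (e (some (i, a)))) (g i)) :
    ∑' a, F a = F (e none) + ∑ i, g i := by
  have hsome : Summable fun x : ι × α => F (e (some x)) :=
    (e.summable_iff.2 hF).comp_injective (Option.some_injective _)
  have htot := hsome.hasSum
  rw [(htot.prod_fiberwise hg).unique (hasSum_fintype _)] at htot
  let E : (ι × α) ⊕ PUnit.{1} ≃ Option (ι × α) := (Equiv.optionEquivSumPUnit _).symm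
  have hsum : HasSum (fun x => F (e (E x))) (∑ i, g i + F (e none)) :=
    HasSum.sum htot (hasSum_unique fun _ : PUnit => F (e none))
  rw [add_comm]
  exact ((E.trans e).hasSum_iff.1 hsum).tsum_eq

lemma coinE_replicate_eq {p : ℝ} (hp : 0 < p) (hp1 : p < 1) {k : ℕ} (hk : 1 ≤ k) (n : ℕ) :
    coinE p (List.replicate k true) n = (k : ℝ) ^ n * p ^ k +
      ∑ i : Fin k, p ^ (i : ℕ) * (1 - p) * ∑ j ∈ Finset.range (n + 1),
        (n.choose j : ℝ) * ((i : ℕ) + 1 : ℝ) ^ (n - j) * coinE p (List.replicate k true) j := by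
  have hs := summable_length_pow_mul_coinP hp hp1 hk
  have hblock : ∀ i : Fin k, HasSum (fun w => ((runDecomp k hk (some (i, w))).1.length : ℝ) ^ n *
      coinP p (runDecomp k hk (some (i, w))).1)
      (p ^ (i : ℕ) * (1 - p) * ∑ j ∈ Finset.range (n + 1),
        (n.choose j : ℝ) * ((i : ℕ) + 1 : ℝ) ^ (n - j) * coinE p (List.replicate k true) j) := by
    intro i
    have h := (hasSum_sum (s := Finset.range (n + 1)) fun j _ =>
      (hs j).hasSum.mul_left ((n.choose j : ℝ) * ((i : ℕ) + 1 : ℝ) ^ (n - j))).mul_left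
        (p ^ (i : ℕ) * (1 - p))
    refine (congrArg (fun f => HasSum f _) (funext fun w => ?_)).mpr h
    simp only [runDecomp, coinP_replicate_append_false, List.length_append,
      List.length_replicate, List.length_cons]
    push_cast
    rw [show ((i : ℕ) + (w.1.length + 1) : ℝ) = w.1.length + ((i : ℕ) + 1) by ring, add_pow,
      Finset.sum_mul, Finset.mul_sum]
    exact Finset.sum_congr rfl fun j _ => by ring
  have h := tsum_eq_add_sum_of_optionProd_equiv
    (Equiv.ofBijective _ (runDecomp_bijective k hk)) (hs n) hblock
  simpa [coinE, runDecomp, coinP_replicate] using h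

/-- Recursive formula for the moments when `S = H^k`. -/
theorem stmt_5 (p : ℝ) (hp : 0 < p) (hp1 : p < 1) (k : ℕ) (hk : 1 ≤ k) :
    coinE p (List.replicate k true) 0 = 1 ∧
      ∀ n : ℕ, 1 ≤ n →
        coinE p (List.replicate k true) n =
          (k : ℝ) ^ n +
            ∑ j ∈ Finset.range n, (n.choose j : ℝ) * coinE p (List.replicate k true) j *
              ∑ i ∈ Finset.Icc 1 k, (1 - p) * (i : ℝ) ^ (n - j) / p ^ (k - i + 1) := by
  have hpk : p ^ k ≠ 0 := (pow_pos hp k).ne'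
  constructor
  · have h := coinE_replicate_eq hp hp1 hk 0
    simp only [zero_add, Finset.sum_range_one, Nat.choose_self, Nat.cast_one, pow_zero,
      Nat.sub_self, one_mul] at h
    rw [← Finset.sum_mul, sum_pow_mul_one_sub] at h
    exact mul_left_cancel₀ hpk (by linarith)
  · intro n _
    have h := coinE_replicate_eq hp hp1 hk n
    simp only [Finset.sum_range_succ, Nat.choose_self, Nat.cast_one, Nat.sub_self, pow_zero,
      one_mul, mul_add, Finset.sum_add_distrib] at h
    rw [← Finset.sum_mul, sum_pow_mul_one_sub] at h
    have hi : ∀ m : ℕ, p ^ k * ∑ i ∈ Finset.Icc 1 k, (1 - p) * (i : ℝ) ^ m / p ^ (k - i + 1) =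
        ∑ i : Fin k, p ^ (i : ℕ) * (1 - p) * ((i : ℕ) + 1 : ℝ) ^ m := by
      intro m
      rw [Fin.sum_univ_eq_sum_range (fun i => p ^ i * (1 - p) * ((i : ℝ) + 1) ^ m),
        Finset.range_eq_Ico, Finset.mul_sum, ← Finset.Ico_add_one_right_eq_Icc,
        ← Finset.sum_Ico_add' _ 0 k 1]
      refine Finset.sum_congr rfl fun i hi => ?_
      have hik := (Finset.mem_Ico.1 hi).2
      have hpow : p ^ k = p ^ i * p ^ (k - (i + 1) + 1) := by
        rw [← pow_add]
        congr 1
        omega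
      rw [hpow]
      push_cast
      field_simp
    refine mul_left_cancel₀ hpk ?_
    have hsum : p ^ k * ∑ j ∈ Finset.range n,
        (n.choose j : ℝ) * coinE p (List.replicate k true) j *
          ∑ i ∈ Finset.Icc 1 k, (1 - p) * (i : ℝ) ^ (n - j) / p ^ (k - i + 1) =
        ∑ i : Fin k, p ^ (i : ℕ) * (1 - p) * ∑ j ∈ Finset.range n,
          (n.choose j : ℝ) * ((i : ℕ) + 1 : ℝ) ^ (n - j) *
            coinE p (List.replicate k true) j := by
      simp only [Finset.mul_sum (Finset.range n)]
      rw [Finset.sum_comm]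
      refine Finset.sum_congr rfl fun j _ => ?_
      rw [mul_left_comm, hi, Finset.mul_sum]
      exact Finset.sum_congr rfl fun i _ => by ring
    rw [mul_add, hsum]
    linarith
end

section
/- Let k ≥ 1 and let S = H^k T (a run of k heads followed by one tails). Then E(Y) = 1 / ((1−p) p^k). -/
open Filter Topology

/-! ### Bifix-free words -/

/-- A word is bifix-free if its only borders are the empty word and itself. -/
def BifixFree {α : Type*} (S : List α) : Prop :=
  ∀ u : List α, u <+: S → u <:+ S → u = [] ∨ u = S

theorem bifixFree_replicate_append {α : Type*} {a b : α} (hab : a ≠ b) (k : ℕ) :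
    BifixFree (List.replicate k a ++ [b]) := by
  intro u hpre hsuf
  rcases List.eq_nil_or_concat u with rfl | ⟨v, c, rfl⟩
  · exact Or.inl rfl
  right
  obtain ⟨r, hr⟩ := hsuf
  rw [List.concat_eq_append] at hpre hr ⊢
  rw [← List.append_assoc] at hr
  obtain ⟨-, hc⟩ := List.append_inj' hr rfl
  obtain rfl : c = b := by simpa using hc
  refine hpre.eq_of_length_le ?_
  by_contra! hlt
  have hpre' : v ++ [c] <+: List.replicate k a :=
    List.prefix_of_prefix_length_le hpre (List.prefix_append _ _) (by simpa using hlt)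
  exact hab (List.eq_of_mem_replicate (hpre'.subset (by simp : c ∈ v ++ [c]))).symm

theorem BifixFree.eq_nil_of_append_eq {α : Type*} {S v a b : List α} (hS : BifixFree S)
    (hne : S ≠ []) (hv : ¬ S <:+: v) (h : v ++ S = a ++ S ++ b) : b = [] := by
  rw [List.append_assoc] at h
  rcases List.append_eq_append_iff.1 h with ⟨c, rfl, hc⟩ | ⟨c, rfl, hc⟩
  · have := congrArg List.length hc
    simp only [List.length_append] at this
    exact List.eq_nil_of_length_eq_zero (by omega)
  · rcases List.append_eq_append_iff.1 hc with ⟨d, rfl, -⟩ | ⟨d, hd, hb⟩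
    · exact absurd ⟨a, d, by simp⟩ hv
    · rcases hS d ⟨b, hb.symm⟩ ⟨c, hd.symm⟩ with rfl | rfl
      · exact absurd ⟨a, [], by simp [hd]⟩ hv
      · simpa using hb

theorem append_eq_of_drop_take_eq {α : Type*} {S w : List α} {i : ℕ}
    (h : (w.drop i).take S.length = S) : w = w.take i ++ S ++ (w.drop i).drop S.length := by
  conv_lhs => rw [← List.take_append_drop i w, ← List.take_append_drop S.length (w.drop i), h]
  simp

theorem mem_coinZ_iff {S : List Bool} (hS : BifixFree S) (hne : S ≠ []) (w : List Bool) :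
    w ∈ coinZ S ↔ ∃ v, w = v ++ S ∧ ¬ S <:+: v := by
  constructor
  · rintro ⟨⟨v, rfl⟩, h⟩
    refine ⟨v, rfl, ?_⟩
    rintro ⟨a, b, rfl⟩
    have hcard := Finset.card_le_one.1 (le_of_eq h)
    have := hcard a.length (by simp) (a ++ S ++ b).length (by simp)
    simp at this
    exact hne this.1
  · rintro ⟨v, rfl, hv⟩
    refine ⟨⟨v, rfl⟩, Finset.card_eq_one.2 ⟨v.length, ?_⟩⟩
    ext i
    simp only [Finset.mem_filter, Finset.mem_range, Finset.mem_singleton]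
    constructor
    · rintro ⟨hi, h⟩
      have h' := append_eq_of_drop_take_eq h
      have hb := hS.eq_nil_of_append_eq hne hv h'
      rw [hb] at h'
      have := congrArg List.length h'
      simp only [List.length_append, List.length_take, List.length_nil] at this
      simp only [List.length_append] at hi
      omega
    · rintro rfl
      simp

/-! ### Words of a given length -/

/-- The binary words of length `n`. -/
noncomputable def binWords (n : ℕ) : Finset (List Bool) := (List.finite_length_eq Bool n).toFinset

@[simp] theorem mem_binWords {n : ℕ} {w : List Bool} : w ∈ binWords n ↔ w.length = n := by
  simp [binWords]

theorem sum_binWords_succ {M : Type*} [AddCommMonoid M] (n : ℕ) (f : List Bool → M) :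
    ∑ w ∈ binWords (n + 1), f w = ∑ v ∈ binWords n, (f (v ++ [true]) + f (v ++ [false])) := by
  have h : ∑ x ∈ binWords n ×ˢ (Finset.univ : Finset Bool), f (x.1 ++ [x.2])
      = ∑ w ∈ binWords (n + 1), f w := by
    refine Finset.sum_bij (fun x _ => x.1 ++ [x.2]) ?_ ?_ ?_ ?_
    · simp
    · rintro ⟨a, b⟩ - ⟨c, d⟩ - h
      simpa using List.append_inj' h rfl
    · intro w hw
      rcases List.eq_nil_or_concat w with rfl | ⟨v, c, rfl⟩
      · simp at hw
      · exact ⟨(v, c), by simpa using hw, by simp⟩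
    · simp
  rw [← h, Finset.sum_product]
  simp

theorem hasSum_of_hasSum_binWords {f : List Bool → ℝ} (hf : ∀ w, 0 ≤ f w) {a : ℝ}
    (h : HasSum (fun n => ∑ w ∈ binWords n, f w) a) : HasSum f a := by
  classical
  let B : ℕ → Finset (List Bool) := fun N => (Finset.range N).biUnion binWords
  have hmem : ∀ N w, w ∈ B N ↔ w.length < N := by simp [B]
  have hB : ∀ N, ∑ w ∈ B N, f w = ∑ n ∈ Finset.range N, ∑ w ∈ binWords n, f w := by
    intro N
    refine Finset.sum_biUnion fun m _ n _ hmn => Finset.disjoint_left.2 fun w hm hn => ?_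
    exact hmn ((mem_binWords.1 hm).symm.trans (mem_binWords.1 hn))
  have hmono : Monotone B := fun M N hMN w hw =>
    (hmem _ _).2 (((hmem _ _).1 hw).trans_le hMN)
  have htop : Tendsto B atTop atTop :=
    tendsto_atTop_finset_of_monotone hmono fun w => ⟨w.length + 1, by simp [hmem]⟩
  have hsum : Summable f := by
    refine summable_of_sum_le (c := a) hf fun u => ?_
    have hu : u ⊆ B (u.sup List.length + 1) := fun w hw =>
      (hmem _ _).2 (Nat.lt_succ_of_le (Finset.le_sup (f := List.length) hw))
    refine (Finset.sum_le_sum_of_subset_of_nonneg hu fun w _ _ => hf w).trans ?_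
    rw [hB]
    exact sum_le_hasSum _ (fun n _ => Finset.sum_nonneg fun w _ => hf w) h
  have hlim : Tendsto (fun N => ∑ w ∈ B N, f w) atTop (𝓝 a) := by
    simpa only [hB] using h.tendsto_sum_nat
  rw [tendsto_nhds_unique hlim (hsum.hasSum.comp htop)]
  exact hsum.hasSum

/-! ### Series of tails -/

theorem tendsto_nat_mul_zero_of_antitone_of_summable {q : ℕ → ℝ} (hq : Antitone q)
    (h0 : ∀ n, 0 ≤ q n) (hs : Summable q) : Tendsto (fun n : ℕ => (n : ℝ) * q n) atTop (𝓝 0) := by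
  have hlim := hs.hasSum.tendsto_sum_nat
  have hhalf : Tendsto (fun n : ℕ => n / 2) atTop atTop :=
    Nat.tendsto_div_const_atTop two_ne_zero
  have hdiff := ((hlim.sub (hlim.comp hhalf)).const_mul 2)
  simp only [sub_self, mul_zero] at hdiff
  refine squeeze_zero (fun n => mul_nonneg n.cast_nonneg (h0 n)) (fun n => ?_) hdiff
  have hle : n / 2 ≤ n := Nat.div_le_self n 2
  have hsum : ∑ i ∈ Finset.range n, q i - ∑ i ∈ Finset.range (n / 2), q i
      = ∑ i ∈ Finset.Ico (n / 2) n, q i := (Finset.sum_Ico_eq_sub q hle).symm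
  have hbound : ((n - n / 2 : ℕ) : ℝ) * q n ≤ ∑ i ∈ Finset.Ico (n / 2) n, q i := by
    have := Finset.card_nsmul_le_sum (Finset.Ico (n / 2) n) q (q n)
      fun i hi => hq (Finset.mem_Ico.1 hi).2.le
    simpa using this
  have hcast : (n : ℝ) ≤ 2 * ((n - n / 2 : ℕ) : ℝ) := by
    exact_mod_cast (by omega : n ≤ 2 * (n - n / 2))
  simp only [Function.comp]
  rw [hsum]
  nlinarith [mul_le_mul_of_nonneg_right hcast (h0 n)]

theorem hasSum_nat_mul_of_tail {q z : ℕ → ℝ} (h0 : ∀ n, 0 ≤ q n) (hz : ∀ n, 0 ≤ z n)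
    (hqz : ∀ n, q n = q (n + 1) + z (n + 1)) {a : ℝ} (hq : HasSum q a) :
    HasSum (fun n : ℕ => (n : ℝ) * z n) a := by
  rw [hasSum_iff_tendsto_nat_of_nonneg fun n => mul_nonneg n.cast_nonneg (hz n)]
  have hanti : Antitone q := antitone_nat_of_succ_le fun n => by
    linarith [hqz n, hz (n + 1)]
  have hpart : ∀ N : ℕ, ∑ n ∈ Finset.range (N + 1), (n : ℝ) * z n
      = ∑ n ∈ Finset.range N, q n - N * q N := by
    intro N
    induction N with
    | zero => simp
    | succ N ih =>
      rw [Finset.sum_range_succ, ih, Finset.sum_range_succ, hqz N]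
      push_cast
      ring
  rw [← tendsto_add_atTop_iff_nat 1]
  simpa [hpart] using hq.tendsto_sum_nat.sub
    (tendsto_nat_mul_zero_of_antitone_of_summable hanti h0 hq.summable)

theorem hasSum_of_delayed_recurrence {q : ℕ → ℝ} {s : ℝ} (hs : 0 < s) (h0 : ∀ n, 0 ≤ q n) {d : ℕ}
    (hd : q d = 1) (hrec : ∀ n, q (n + d) = q (n + 1 + d) + s * q n) : HasSum q (1 / s) := by
  have hpart : ∀ N, s * ∑ n ∈ Finset.range N, q n = 1 - q (N + d) := by
    intro N
    induction N with
    | zero => simp [hd]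
    | succ N ih => rw [Finset.sum_range_succ, mul_add, ih, hrec N]; ring
  have hsum : Summable q := by
    refine summable_of_sum_range_le (c := 1 / s) h0 fun N => ?_
    rw [le_div_iff₀' hs, hpart]
    linarith [h0 (N + d)]
  have hlim : Tendsto (fun N => (1 - q (N + d)) / s) atTop (𝓝 ((1 - 0) / s)) :=
    ((hsum.tendsto_atTop_zero.comp (tendsto_add_atTop_nat d)).const_sub 1).div_const s
  rw [hasSum_iff_tendsto_nat_of_nonneg h0]
  refine (hlim.congr fun N => ?_).trans (by simp)
  rw [← hpart, mul_div_cancel_left₀ _ hs.ne']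

/-! ### The expected waiting time of a bifix-free word -/

theorem coinP_append (p : ℝ) (v w : List Bool) : coinP p (v ++ w) = coinP p v * coinP p w := by
  simp [coinP]

theorem coinP_pos {p : ℝ} (hp : 0 < p) (hp1 : p < 1) (w : List Bool) : 0 < coinP p w := by
  refine List.prod_pos fun x hx => ?_
  obtain ⟨b, -, rfl⟩ := List.mem_map.1 hx
  cases b <;> simp [hp, hp1]

open scoped Classical in
/-- The probability that `S` has not occurred during the first `n` flips. -/
noncomputable def avoidMass (p : ℝ) (S : List Bool) (n : ℕ) : ℝ :=
  ∑ w ∈ binWords n, if S <:+: w then 0 else coinP p w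

open scoped Classical in
/-- The probability that `S` first occurs at the `n`-th flip. -/
noncomputable def hitMass (p : ℝ) (S : List Bool) (n : ℕ) : ℝ :=
  ∑ w ∈ binWords n, if w ∈ coinZ S then coinP p w else 0

theorem avoidMass_nonneg {p : ℝ} (hp : 0 < p) (hp1 : p < 1) (S : List Bool) (n : ℕ) :
    0 ≤ avoidMass p S n :=
  Finset.sum_nonneg fun w _ => by split_ifs; exacts [le_rfl, (coinP_pos hp hp1 w).le]

theorem hitMass_nonneg {p : ℝ} (hp : 0 < p) (hp1 : p < 1) (S : List Bool) (n : ℕ) :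
    0 ≤ hitMass p S n :=
  Finset.sum_nonneg fun w _ => by split_ifs; exacts [(coinP_pos hp hp1 w).le, le_rfl]

theorem avoidMass_zero (p : ℝ) {S : List Bool} (hne : S ≠ []) : avoidMass p S 0 = 1 := by
  have h : binWords 0 = {[]} := by ext w; simp
  simp [avoidMass, h, hne, coinP]

theorem hitMass_of_lt (p : ℝ) {S : List Bool} {n : ℕ} (hn : n < S.length) : hitMass p S n = 0 := by
  refine Finset.sum_eq_zero fun w hw => if_neg fun hmem => ?_
  have := hmem.1.length_le
  rw [mem_binWords.1 hw] at this
  omega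

theorem append_singleton_mem_coinZ_iff {S : List Bool} (hS : BifixFree S) (hne : S ≠ [])
    (w : List Bool) (b : Bool) : w ++ [b] ∈ coinZ S ↔ S <:+: w ++ [b] ∧ ¬ S <:+: w := by
  rw [mem_coinZ_iff hS hne]
  constructor
  · rintro ⟨v, hw, hv⟩
    refine ⟨⟨v, [], by simp [hw]⟩, ?_⟩
    rintro ⟨x, y, rfl⟩
    have := hS.eq_nil_of_append_eq (a := x) (b := y ++ [b]) hne hv (by simp [← hw])
    simp at this
  · rintro ⟨⟨x, y, h⟩, hw⟩
    rcases List.eq_nil_or_concat y with rfl | ⟨y, c, rfl⟩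
    · refine ⟨x, by simpa using h.symm, fun hx => hw ?_⟩
      have hxw : x <+: w := by
        refine List.prefix_of_prefix_length_le (l₃ := w ++ [b]) ⟨S, by simpa using h⟩
          (List.prefix_append _ _) ?_
        have := congrArg List.length h
        have := List.length_pos_of_ne_nil hne
        simp at *
        omega
      exact hx.trans hxw.isInfix
    · rw [List.concat_eq_append, ← List.append_assoc] at h
      exact absurd ⟨x, y, (List.append_inj' h rfl).1⟩ hw

theorem avoidMass_eq_add_hitMass (p : ℝ) {S : List Bool} (hS : BifixFree S) (hne : S ≠ [])
    (n : ℕ) : avoidMass p S n = avoidMass p S (n + 1) + hitMass p S (n + 1) := by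
  classical
  have hstep : ∀ (w : List Bool) (b : Bool),
      ((if S <:+: w ++ [b] then 0 else coinP p (w ++ [b]))
        + if w ++ [b] ∈ coinZ S then coinP p (w ++ [b]) else 0)
      = if S <:+: w then 0 else coinP p (w ++ [b]) := by
    intro w b
    have hmono : S <:+: w → S <:+: w ++ [b] := fun h => h.trans (List.prefix_append _ _).isInfix
    rw [append_singleton_mem_coinZ_iff hS hne]
    by_cases h₁ : S <:+: w
    · simp [h₁, hmono h₁]
    · by_cases h₂ : S <:+: w ++ [b] <;> simp [h₁, h₂]
  unfold avoidMass hitMass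
  rw [← Finset.sum_add_distrib, sum_binWords_succ]
  refine Finset.sum_congr rfl fun w _ => ?_
  rw [hstep, hstep]
  split_ifs
  · simp
  · rw [coinP_append, coinP_append]
    simp [coinP]
    ring

theorem hitMass_add_length (p : ℝ) {S : List Bool} (hS : BifixFree S) (hne : S ≠ []) (n : ℕ) :
    hitMass p S (n + S.length) = coinP p S * avoidMass p S n := by
  classical
  unfold hitMass avoidMass
  rw [Finset.mul_sum]
  simp only [mul_ite, mul_zero, ← ite_not (S <:+: _)]
  rw [← Finset.sum_filter, ← Finset.sum_filter]
  symm
  refine Finset.sum_bij (fun v _ => v ++ S) ?_ ?_ ?_ ?_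
  · intro v hv
    simp only [Finset.mem_filter, mem_binWords] at hv ⊢
    exact ⟨by simp [hv.1], (mem_coinZ_iff hS hne _).2 ⟨v, rfl, hv.2⟩⟩
  · intro v _ v' _ h
    exact List.append_cancel_right h
  · intro w hw
    simp only [Finset.mem_filter, mem_binWords] at hw
    obtain ⟨v, rfl, hv⟩ := (mem_coinZ_iff hS hne _).1 hw.2
    exact ⟨v, by simpa [hv] using hw.1, rfl⟩
  · intro v _
    rw [coinP_append, mul_comm]

theorem hasSum_avoidMass {p : ℝ} (hp : 0 < p) (hp1 : p < 1) {S : List Bool} (hS : BifixFree S)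
    (hne : S ≠ []) : HasSum (avoidMass p S) (1 / coinP p S) := by
  obtain ⟨d, hd⟩ := Nat.exists_eq_add_one_of_ne_zero (List.length_pos_of_ne_nil hne).ne'
  have hone : ∀ n ≤ d, avoidMass p S n = 1 := by
    intro n
    induction n with
    | zero => exact fun _ => avoidMass_zero p hne
    | succ n ih =>
      intro hn
      have h := avoidMass_eq_add_hitMass p hS hne n
      rw [ih (by omega), hitMass_of_lt p (by omega)] at h
      linarith
  refine hasSum_of_delayed_recurrence (coinP_pos hp hp1 S) (avoidMass_nonneg hp hp1 S)
    (hone d le_rfl) fun n => ?_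
  rw [avoidMass_eq_add_hitMass p hS hne (n + d), ← hitMass_add_length p hS hne, hd]
  congr 2
  omega

theorem coinE_one_of_bifixFree {p : ℝ} (hp : 0 < p) (hp1 : p < 1) {S : List Bool}
    (hS : BifixFree S) (hne : S ≠ []) : coinE p S 1 = 1 / coinP p S := by
  classical
  rw [coinE, tsum_subtype (coinZ S) fun w => (w.length : ℝ) ^ 1 * coinP p w]
  refine HasSum.tsum_eq (hasSum_of_hasSum_binWords (fun w => Set.indicator_nonneg
    (fun w _ => mul_nonneg (by positivity) (coinP_pos hp hp1 w).le) w) ?_)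
  convert hasSum_nat_mul_of_tail (avoidMass_nonneg hp hp1 S) (hitMass_nonneg hp hp1 S)
    (avoidMass_eq_add_hitMass p hS hne) (hasSum_avoidMass hp hp1 hS hne) using 2 with n
  rw [hitMass, Finset.mul_sum]
  refine Finset.sum_congr rfl fun w hw => ?_
  simp [Set.indicator_apply, mem_binWords.1 hw]

/-- For `S = H^k T`, `E(Y) = 1/((1-p) p^k)`. -/
theorem stmt_9 (p : ℝ) (hp : 0 < p) (hp1 : p < 1) (k : ℕ) (hk : 1 ≤ k) :
    coinE p (List.replicate k true ++ [false]) 1 = 1 / ((1 - p) * p ^ k) := by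
  rw [coinE_one_of_bifixFree hp hp1 (bifixFree_replicate_append (by simp) k) (by simp)]
  simp [coinP, mul_comm]
end

section
/- Let f, g : ℝ → ℝ be infinitely differentiable functions and let Ω denote the operator sending a differentiable function h to the function x ↦ x · h'(x). Then for every integer n ≥ 1 and every x ∈ ℝ, (Ω^n (f ∘ g))(x) = ∑_{π ∈ Π_n} f^{(|π|)}(g(x)) · ∏_{B ∈ π} (Ω^{|B|} g)(x), where Π_n is the set of all partitions of the set {1, …, n}, |π| is the number of blocks of a partition π, and |B| is the size of a block B. -/
/-- The set of all partitions of `{1, …, n}` (modeled as `Fin n`), each partition being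
the finite set of its blocks: nonempty pairwise disjoint subsets covering `Fin n`
(every element lies in exactly one block). -/
noncomputable def setPartitions (n : ℕ) : Finset (Finset (Finset (Fin n))) := by
  classical
  exact Finset.univ.filter fun P =>
    (∀ B ∈ P, B.Nonempty) ∧ ∀ x : Fin n, ∃! B, B ∈ P ∧ x ∈ B

open Classical in
/-- The set of all partitions of the finite set `s`, each given by the finite set of its blocks. -/
noncomputable def partitionsOf {α : Type*} (s : Finset α) : Finset (Finset (Finset α)) :=
  s.powerset.powerset.filter fun P =>
    (∀ B ∈ P, B.Nonempty) ∧ ∀ x ∈ s, ∃! B, B ∈ P ∧ x ∈ B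

lemma mem_partitionsOf {α : Type*} {s : Finset α} {P : Finset (Finset α)} :
    P ∈ partitionsOf s ↔
      (∀ B ∈ P, B ⊆ s) ∧ (∀ B ∈ P, B.Nonempty) ∧ ∀ x ∈ s, ∃! B, B ∈ P ∧ x ∈ B := by
  simp [partitionsOf, Finset.subset_iff (s₂ := s.powerset)]

lemma partitionsOf_empty {α : Type*} : partitionsOf (∅ : Finset α) = {∅} := by
  ext P
  simp only [mem_partitionsOf, Finset.mem_singleton, Finset.subset_empty]
  constructor
  · rintro ⟨h₁, h₂, -⟩
    refine Finset.eq_empty_of_forall_notMem fun B hB => ?_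
    simpa [h₁ B hB] using h₂ B hB
  · rintro rfl
    simp

lemma empty_notMem_of_mem_partitionsOf {α : Type*} {s : Finset α} {Q : Finset (Finset α)}
    (hQ : Q ∈ partitionsOf s) :
    ∅ ∉ Q :=
  fun h => by simpa using (mem_partitionsOf.1 hQ).2.1 _ h

section Insert

variable {α : Type*} [DecidableEq α] {a : α} {s : Finset α}

/-- Adding the element `a` to the block `B` of `Q`, or as a new singleton block if `B = ∅`. -/
lemma insert_block_mem_partitionsOf (ha : a ∉ s) {Q : Finset (Finset α)}
    (hQ : Q ∈ partitionsOf s) {B : Finset α} (hB : B ∈ insert ∅ Q) :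
    insert (insert a B) (Q.erase B) ∈ partitionsOf (insert a s) := by
  obtain ⟨h₁, h₂, h₃⟩ := mem_partitionsOf.1 hQ
  have hBs : B ⊆ s := by
    rcases Finset.mem_insert.1 hB with rfl | h
    · simp
    · exact h₁ B h
  refine mem_partitionsOf.2 ⟨?_, ?_, ?_⟩
  · intro C hC
    rcases Finset.mem_insert.1 hC with rfl | hC
    · exact Finset.insert_subset_insert a hBs
    · exact (h₁ C (Finset.mem_of_mem_erase hC)).trans (Finset.subset_insert a s)
  · intro C hC
    rcases Finset.mem_insert.1 hC with rfl | hC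
    · exact Finset.insert_nonempty a B
    · exact h₂ C (Finset.mem_of_mem_erase hC)
  · intro x hx
    rcases Finset.mem_insert.1 hx with rfl | hx
    · refine ⟨insert x B, by simp, ?_⟩
      rintro C ⟨hC, hxC⟩
      rcases Finset.mem_insert.1 hC with rfl | hC
      · rfl
      · exact absurd (h₁ C (Finset.mem_of_mem_erase hC) hxC) ha
    · have hxa : x ≠ a := fun h => ha (h ▸ hx)
      obtain ⟨C, ⟨hC, hxC⟩, hu⟩ := h₃ x hx
      by_cases hCB : C = B
      · subst hCB
        refine ⟨insert a C, by simp [hxC], ?_⟩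
        rintro D ⟨hD, hxD⟩
        rcases Finset.mem_insert.1 hD with rfl | hD
        · rfl
        · exact absurd (hu D ⟨Finset.mem_of_mem_erase hD, hxD⟩) (Finset.ne_of_mem_erase hD)
      · refine ⟨C, ⟨by simp [hC, hCB], hxC⟩, ?_⟩
        rintro D ⟨hD, hxD⟩
        rcases Finset.mem_insert.1 hD with rfl | hD
        · have hxB : x ∈ B := Finset.mem_of_mem_insert_of_ne hxD hxa
          rcases Finset.mem_insert.1 hB with rfl | hB
          · simp at hxB
          · exact absurd (hu B ⟨hB, hxB⟩).symm hCB
        · exact hu D ⟨Finset.mem_of_mem_erase hD, hxD⟩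

lemma insert_block_notMem (ha : a ∉ s) {Q : Finset (Finset α)} (hQ : Q ∈ partitionsOf s)
    (B : Finset α) : insert a B ∉ Q :=
  fun h => ha ((mem_partitionsOf.1 hQ).1 _ h (Finset.mem_insert_self a B))

/-- The partition `Q` is recovered from the partition obtained by adding `a` to the block `B`. -/
lemma erase_insert_block (ha : a ∉ s) {Q : Finset (Finset α)} (hQ : Q ∈ partitionsOf s)
    {B : Finset α} (hB : B ∈ insert ∅ Q) :
    (insert B ((insert (insert a B) (Q.erase B)).erase (insert a B))).erase ∅ = Q := by
  have h₀ := empty_notMem_of_mem_partitionsOf hQ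
  rw [Finset.erase_insert fun h => insert_block_notMem ha hQ B (Finset.mem_of_mem_erase h)]
  rcases Finset.mem_insert.1 hB with rfl | hB
  · rw [Finset.erase_eq_of_notMem h₀, Finset.erase_insert h₀]
  · rw [Finset.insert_erase hB, Finset.erase_eq_of_notMem h₀]

/-- Removing `a` from its block `A` in a partition of `insert a s`. -/
lemma erase_block_mem_partitionsOf (ha : a ∉ s) {P : Finset (Finset α)}
    (hP : P ∈ partitionsOf (insert a s)) {A : Finset α} (hA : A ∈ P) (haA : a ∈ A) :
    (insert (A.erase a) (P.erase A)).erase ∅ ∈ partitionsOf s := by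
  obtain ⟨h₁, h₂, h₃⟩ := mem_partitionsOf.1 hP
  have hau : ∀ C ∈ P, a ∈ C → C = A := fun C hC haC =>
    (h₃ a (Finset.mem_insert_self a s)).unique ⟨hC, haC⟩ ⟨hA, haA⟩
  refine mem_partitionsOf.2 ⟨?_, ?_, ?_⟩
  · intro C hC x hx
    rcases Finset.mem_insert.1 (Finset.mem_of_mem_erase hC) with rfl | hC
    · exact Finset.mem_of_mem_insert_of_ne (h₁ A hA (Finset.mem_of_mem_erase hx))
        (Finset.ne_of_mem_erase hx)
    · have hCP := Finset.mem_of_mem_erase hC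
      refine Finset.mem_of_mem_insert_of_ne (h₁ C hCP hx) fun hxa => ?_
      exact Finset.ne_of_mem_erase hC (hau C hCP (hxa ▸ hx))
  · intro C hC
    exact Finset.nonempty_iff_ne_empty.2 (Finset.ne_of_mem_erase hC)
  · intro x hx
    have hxa : x ≠ a := fun h => ha (h ▸ hx)
    obtain ⟨C, ⟨hC, hxC⟩, hu⟩ := h₃ x (Finset.mem_insert_of_mem hx)
    by_cases hCA : C = A
    · subst hCA
      have hxC' : x ∈ C.erase a := Finset.mem_erase.2 ⟨hxa, hxC⟩
      refine ⟨C.erase a, ⟨Finset.mem_erase.2 ⟨Finset.ne_empty_of_mem hxC', by simp⟩, hxC'⟩, ?_⟩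
      rintro D ⟨hD, hxD⟩
      rcases Finset.mem_insert.1 (Finset.mem_of_mem_erase hD) with rfl | hD
      · rfl
      · exact absurd (hu D ⟨Finset.mem_of_mem_erase hD, hxD⟩) (Finset.ne_of_mem_erase hD)
    · refine ⟨C, ⟨by simp [hC, hCA, Finset.ne_empty_of_mem hxC], hxC⟩, ?_⟩
      rintro D ⟨hD, hxD⟩
      rcases Finset.mem_insert.1 (Finset.mem_of_mem_erase hD) with rfl | hD
      · exact absurd (hu A ⟨hA, Finset.mem_of_mem_erase hxD⟩).symm hCA
      · exact hu D ⟨Finset.mem_of_mem_erase hD, hxD⟩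

/-- The block of `a` can be put back into the partition from which `a` was removed. -/
lemma insert_erase_block {P : Finset (Finset α)}
    (hP : P ∈ partitionsOf (insert a s)) {A : Finset α} (hA : A ∈ P) (haA : a ∈ A) :
    insert (insert a (A.erase a))
      (((insert (A.erase a) (P.erase A)).erase ∅).erase (A.erase a)) = P := by
  have hAP : A.erase a ∉ P.erase A := by
    intro h
    obtain ⟨-, h₂, h₃⟩ := mem_partitionsOf.1 hP
    obtain ⟨x, hx⟩ := h₂ _ (Finset.mem_of_mem_erase h)
    have hxA := Finset.mem_of_mem_erase hx
    exact Finset.ne_of_mem_erase h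
      ((h₃ x ((mem_partitionsOf.1 hP).1 A hA hxA)).unique
        ⟨Finset.mem_of_mem_erase h, hx⟩ ⟨hA, hxA⟩)
  have h₀ : ∅ ∉ P.erase A := fun h =>
    empty_notMem_of_mem_partitionsOf hP (Finset.mem_of_mem_erase h)
  rw [Finset.erase_right_comm, Finset.erase_insert hAP, Finset.erase_eq_of_notMem h₀,
    Finset.insert_erase haA, Finset.insert_erase hA]

/-- A partition of `insert a s` arises from a unique partition `Q` of `s`, either by adding the
block `{a}` or by adding `a` to a block of `Q`. -/
lemma sum_partitionsOf_insert {M : Type*} [AddCommMonoid M] (ha : a ∉ s)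
    (F : Finset (Finset α) → M) :
    ∑ P ∈ partitionsOf (insert a s), F P =
      ∑ Q ∈ partitionsOf s,
        (F (insert {a} Q) + ∑ B ∈ Q, F (insert (insert a B) (Q.erase B))) := by
  have hsum : ∀ Q ∈ partitionsOf s,
      F (insert {a} Q) + ∑ B ∈ Q, F (insert (insert a B) (Q.erase B)) =
        ∑ B ∈ insert ∅ Q, F (insert (insert a B) (Q.erase B)) := by
    intro Q hQ
    have h₀ := empty_notMem_of_mem_partitionsOf hQ
    rw [Finset.sum_insert h₀, Finset.erase_eq_of_notMem h₀, insert_empty_eq]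
  rw [Finset.sum_congr rfl hsum, Finset.sum_sigma']
  symm
  refine Finset.sum_bij (fun p _ => insert (insert a p.2) (p.1.erase p.2)) ?_ ?_ ?_ ?_
  · rintro ⟨Q, B⟩ h
    obtain ⟨hQ, hB⟩ := Finset.mem_sigma.1 h
    exact insert_block_mem_partitionsOf ha hQ hB
  · rintro ⟨Q, B⟩ h ⟨Q', B'⟩ h' heq
    obtain ⟨hQ, hB⟩ := Finset.mem_sigma.1 h
    obtain ⟨hQ', hB'⟩ := Finset.mem_sigma.1 h'
    dsimp only at hQ hB hQ' hB' heq
    have hnot : ∀ {R C : Finset _}, R ∈ partitionsOf s → C ∈ insert ∅ R → a ∉ C := by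
      intro R C hR hC haC
      rcases Finset.mem_insert.1 hC with rfl | hC
      · simp at haC
      · exact ha ((mem_partitionsOf.1 hR).1 C hC haC)
    have hblock : insert a B = insert a B' := by
      refine ((mem_partitionsOf.1 (insert_block_mem_partitionsOf ha hQ hB)).2.2 a
        (Finset.mem_insert_self a s)).unique ⟨by simp, by simp⟩ ⟨?_, by simp⟩
      rw [heq]
      simp
    have hBB : B = B' := by
      rw [← Finset.erase_insert (hnot hQ hB), hblock, Finset.erase_insert (hnot hQ' hB')]
    subst hBB
    have hQQ : Q = Q' := by
      rw [← erase_insert_block ha hQ hB, heq, erase_insert_block ha hQ' hB']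
    rw [hQQ]
  · intro P hP
    obtain ⟨A, ⟨hA, haA⟩, -⟩ := (mem_partitionsOf.1 hP).2.2 a (Finset.mem_insert_self a s)
    refine ⟨⟨(insert (A.erase a) (P.erase A)).erase ∅, A.erase a⟩,
      Finset.mem_sigma.2 ⟨erase_block_mem_partitionsOf ha hP hA haA, ?_⟩,
      insert_erase_block hP hA haA⟩
    by_cases h : A.erase a = ∅ <;> simp [h]
  · intro _ _
    rfl

end Insert

lemma contDiff_iterate_mul_deriv {g : ℝ → ℝ} (hg : ContDiff ℝ (⊤ : ℕ∞) g) (n : ℕ) :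
    ContDiff ℝ (⊤ : ℕ∞) ((fun h : ℝ → ℝ => fun y => y * deriv h y)^[n] g) := by
  induction n with
  | zero => exact hg
  | succ n ih =>
    rw [Function.iterate_succ_apply']
    exact contDiff_id.mul (contDiff_infty_iff_deriv.1 ih).2

/-- Faà di Bruno's formula for `x d/dx`, with the partitions of an arbitrary finite set. -/
lemma iterate_mul_deriv_comp {α : Type*} [DecidableEq α] {f g : ℝ → ℝ}
    (hf : ContDiff ℝ (⊤ : ℕ∞) f) (hg : ContDiff ℝ (⊤ : ℕ∞) g) (s : Finset α) :
    (fun h : ℝ → ℝ => fun y => y * deriv h y)^[s.card] (f ∘ g) = fun x =>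
      ∑ π ∈ partitionsOf s, iteratedDeriv π.card f (g x) *
        ∏ B ∈ π, (fun h : ℝ → ℝ => fun y => y * deriv h y)^[B.card] g x := by
  induction s using Finset.induction_on with
  | empty =>
    ext x
    simp [partitionsOf_empty]
  | insert a s ha ih =>
    rw [Finset.card_insert_of_notMem ha, Function.iterate_succ_apply', ih]
    ext x
    set Ω : (ℝ → ℝ) → ℝ → ℝ := fun h y => y * deriv h y with hΩ
    have hΩg : ∀ k, x * deriv (Ω^[k] g) x = Ω^[k + 1] g x := fun k => by
      rw [Function.iterate_succ_apply']
    have hprod (Q : Finset (Finset α)) :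
        HasDerivAt (fun y => ∏ B ∈ Q, Ω^[B.card] g y)
          (∑ B ∈ Q, (∏ C ∈ Q.erase B, Ω^[C.card] g x) • deriv (Ω^[B.card] g) x) x :=
      HasDerivAt.fun_finsetProd fun B _ =>
        ((contDiff_iterate_mul_deriv hg B.card).differentiable (by simp) x).hasDerivAt
    have hcomp (k : ℕ) : HasDerivAt (fun y => iteratedDeriv k f (g y))
        (iteratedDeriv (k + 1) f (g x) * deriv g x) x := by
      have h := (hf.differentiable_iteratedDeriv k
        (by exact_mod_cast WithTop.coe_lt_top k) (g x)).hasDerivAt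
      rw [← iteratedDeriv_succ] at h
      exact h.comp x (hg.differentiable (by simp) x).hasDerivAt
    have hder := HasDerivAt.fun_sum (u := partitionsOf s) fun Q _ =>
      (hcomp Q.card).mul (hprod Q)
    rw [sum_partitionsOf_insert ha]
    change x * deriv _ x = _
    refine (congrArg (x * ·) hder.deriv).trans ?_
    rw [Finset.mul_sum]
    refine Finset.sum_congr rfl fun Q hQ => ?_
    rw [mul_add]
    congr 1
    · have h : {a} ∉ Q := by simpa using insert_block_notMem ha hQ ∅
      rw [Finset.card_insert_of_notMem h, Finset.prod_insert h, Finset.card_singleton,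
        ← zero_add 1, ← hΩg 0, zero_add, Function.iterate_zero_apply]
      ring
    · rw [Finset.mul_sum, Finset.mul_sum]
      refine Finset.sum_congr rfl fun B hB => ?_
      have h : insert a B ∉ Q.erase B := fun h =>
        insert_block_notMem ha hQ B (Finset.mem_of_mem_erase h)
      have haB : a ∉ B := fun h => ha ((mem_partitionsOf.1 hQ).1 B hB h)
      rw [Finset.card_insert_of_notMem h, Finset.prod_insert h, Finset.card_erase_add_one hB,
        Finset.card_insert_of_notMem haB, ← hΩg, smul_eq_mul]
      ring

lemma setPartitions_eq_partitionsOf_univ (n : ℕ) :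
    setPartitions n = partitionsOf (Finset.univ : Finset (Fin n)) := by
  ext P
  simp [setPartitions, mem_partitionsOf]

/-- Faà di Bruno's formula for the operator `Ω = x d/dx`:
`Ω^n (f ∘ g) = ∑_{π ∈ Π_n} f^{(|π|)}(g(x)) ∏_{B ∈ π} (Ω^{|B|} g)(x)`. -/
theorem stmt_16 (f g : ℝ → ℝ) (hf : ContDiff ℝ (⊤ : ℕ∞) f) (hg : ContDiff ℝ (⊤ : ℕ∞) g)
    (n : ℕ) (hn : 1 ≤ n) (x : ℝ) :
    (fun h : ℝ → ℝ => fun y => y * deriv h y)^[n] (f ∘ g) x =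
      ∑ π ∈ setPartitions n, iteratedDeriv π.card f (g x) *
        ∏ B ∈ π, (fun h : ℝ → ℝ => fun y => y * deriv h y)^[B.card] g x := by
  rw [setPartitions_eq_partitionsOf_univ]
  simpa using congrFun (iterate_mul_deriv_comp hf hg (Finset.univ : Finset (Fin n))) x
end
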